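/- Let q be a real number with |q| > 1/2, set a = 1/(2q), let k ≥ 1 be an integer and l = 2^k. Then for every integer n with 0 ≤ n ≤ l: S_q(n) − (n/l)·S_q(l) = −2^{k−1}·q^k·𝒯_a(n/l). In particular, the deviation of the partial sums S_q from their linear interpolation along the grid n/l is a multiple of the Takagi–Landsberg curve, with normalizing coefficient proportional to (2|q|)^{log₂ l}. -/

import Mathlib

noncomputable section

open MeasureTheory Filter Finset

/-- Distance from `x` to the nearest integer. -/
def distInt (x : ℝ) : ℝ := |x - round x|

/-- The Takagi–Landsberg function with parameter `a`:
`𝒯_a(x) = ∑_{n≥0} a^n · dist(2^n x, ℤ)`. -/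
def takagi (a : ℝ) (x : ℝ) : ℝ := ∑' n : ℕ, a ^ n * distInt (2 ^ n * x)

/-- Weighted sum-of-binary-digits function: for `j = ∑ ω_i 2^i`,
`s_q(j) = ∑ ω_i q^{i+1}`. -/
def sqN (q : ℝ) (j : ℕ) : ℝ := ∑ i ∈ Finset.range j, if j.testBit i then q ^ (i + 1) else 0

/-- `S_q(n) = ∑_{j<n} s_q(j)`. -/
def Sq (q : ℝ) (n : ℕ) : ℝ := ∑ j ∈ Finset.range n, sqN q j

lemma sum_testBit_eq_sum_range {M : Type*} [AddCommMonoid M] (f : ℕ → M) {j m K : ℕ}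
    (hm : j < 2 ^ m) (hmK : m ≤ K) :
    (∑ i ∈ range m, if j.testBit i then f i else 0) =
      ∑ i ∈ range K, if j.testBit i then f i else 0 := by
  refine sum_subset (range_subset_range.2 hmK) fun i _ hi ↦ ?_
  have h : m ≤ i := by simpa using hi
  simp [Nat.testBit_lt_two_pow (hm.trans_le (Nat.pow_le_pow_right two_pos h))]

lemma sqN_eq_sum_range (q : ℝ) {j k : ℕ} (hj : j < 2 ^ k) :
    sqN q j = ∑ i ∈ range k, if j.testBit i then q ^ (i + 1) else 0 := by
  rw [sqN, sum_testBit_eq_sum_range _ Nat.lt_two_pow_self (Nat.le_add_right j k),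
    sum_testBit_eq_sum_range _ hj (Nat.le_add_left k j)]

lemma two_mul_sum_testBit_add_min (i n : ℕ) :
    2 * (∑ j ∈ range n, if j.testBit i then 1 else 0) +
      min (n % 2 ^ (i + 1)) (2 ^ (i + 1) - n % 2 ^ (i + 1)) = n := by
  induction n with
  | zero => simp
  | succ n ih =>
    have hpos : 0 < 2 ^ i := by positivity
    have hbit : n.testBit i ↔ 2 ^ i ≤ n % 2 ^ (i + 1) := by
      have hlt := Nat.mod_lt n (show 0 < 2 ^ i * 2 by positivity)
      rw [Nat.testBit_eq_decide_div_mod_eq, decide_eq_true_iff, ← Nat.mod_mul_right_div_self,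
        pow_succ]
      constructor
      · intro h
        by_contra hc
        rw [Nat.div_eq_of_lt (not_le.1 hc)] at h
        omega
      · intro h
        rw [Nat.div_eq_iff hpos]
        omega
    have hlt := Nat.mod_lt n (show 0 < 2 ^ (i + 1) by positivity)
    rw [sum_range_succ, Nat.add_mod_eq_ite (m := n)]
    have hone : 1 % 2 ^ (i + 1) = 1 := Nat.mod_eq_of_lt (Nat.one_lt_two_pow (by omega))
    rw [hone]
    simp only [hbit]
    rw [pow_succ] at *
    split_ifs <;> omega

lemma sum_testBit_eq_sub_distInt (i n : ℕ) :
    (∑ j ∈ range n, if j.testBit i then (1 : ℝ) else 0) =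
      n / 2 - 2 ^ i * distInt (n / 2 ^ (i + 1)) := by
  have h := congrArg (Nat.cast : ℕ → ℝ) (two_mul_sum_testBit_add_min i n)
  have hd := abs_sub_round_div_natCast_eq (α := ℝ) (m := n) (n := 2 ^ (i + 1))
  push_cast at h hd
  rw [distInt, hd, ← h, pow_succ]
  field_simp
  ring

lemma Sq_eq_sum_distInt (q : ℝ) {n k : ℕ} (hn : n ≤ 2 ^ k) :
    Sq q n = ∑ i ∈ range k, q ^ (i + 1) * (n / 2 - 2 ^ i * distInt (n / 2 ^ (i + 1))) := by
  rw [Sq, sum_congr rfl fun j hj ↦ sqN_eq_sum_range q ((mem_range.1 hj).trans_le hn), sum_comm]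
  refine sum_congr rfl fun i _ ↦ ?_
  rw [← sum_testBit_eq_sub_distInt, mul_sum]
  simp

lemma distInt_natCast (n : ℕ) : distInt n = 0 := by
  simp [distInt]

lemma distInt_two_pow_div {i k : ℕ} (h : i ≤ k) : distInt ((2 : ℝ) ^ k / 2 ^ i) = 0 := by
  obtain ⟨d, rfl⟩ := Nat.exists_eq_add_of_le h
  rw [pow_add, mul_div_cancel_left₀ _ (by positivity)]
  exact_mod_cast distInt_natCast (2 ^ d)

lemma takagi_div_two_pow (a : ℝ) (n k : ℕ) :
    takagi a (n / 2 ^ k) = ∑ m ∈ range k, a ^ m * distInt (2 ^ m * (n / 2 ^ k)) := by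
  refine tsum_eq_sum fun m hm ↦ ?_
  have hkm : k ≤ m := by simpa using hm
  obtain ⟨d, rfl⟩ := Nat.exists_eq_add_of_le hkm
  have : (2 : ℝ) ^ (k + d) * (n / 2 ^ k) = ((2 ^ d * n : ℕ) : ℝ) := by
    push_cast
    field_simp
    ring
  rw [this, distInt_natCast, mul_zero]

theorem Sq_deviation_takagi (q : ℝ) (hq : 1 / 2 < |q|) (a : ℝ) (ha : a = 1 / (2 * q))
    (k : ℕ) (hk : 1 ≤ k) (l : ℕ) (hl : l = 2 ^ k) (n : ℕ) (hn : n ≤ l) :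
    Sq q n - ((n : ℝ) / (l : ℝ)) * Sq q l
      = -((2 : ℝ) ^ (k - 1) * q ^ k * takagi a ((n : ℝ) / (l : ℝ))) := by
  have hq0 : q ≠ 0 := by
    rintro rfl
    norm_num at hq
  subst ha hl
  push_cast
  rw [takagi_div_two_pow, Sq_eq_sum_distInt q hn, Sq_eq_sum_distInt q le_rfl, mul_sum, mul_sum,
    ← sum_sub_distrib, ← sum_neg_distrib, ← sum_range_reflect]
  refine sum_congr rfl fun m hm ↦ ?_
  obtain ⟨d, rfl⟩ : ∃ d, k = d + m + 1 := ⟨k - 1 - m, by have := mem_range.1 hm; omega⟩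
  have harg : (2 : ℝ) ^ m * (n / 2 ^ (d + m + 1)) = n / 2 ^ (d + 1) := by
    field_simp
    ring
  push_cast
  simp only [Nat.add_sub_cancel]
  rw [harg, distInt_two_pow_div (by omega), div_pow, mul_pow, one_pow]
  field_simp
  ring

end
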